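/- Trace generating function (open form): let δ=(δ_1,...,δ_h) be a profile, u_0,u_1,... formal variables, and U_j = u_0 u_1 ⋯ u_{j−1}. For fixed partitions λ^0 and λ^h, the sum over all skew doubled shifted plane partitions ω=(λ^0,λ^1,...,λ^h) with profile δ starting from λ^0 and ending at λ^h of ∏_{i=0}^h u_i^{|λ^i|} equals U_{h+1}^{|λ^h|} · ∏_{1≤i<j≤h, δ_i>δ_j} (1 − U_i^{−1}U_j)^{−1} · Σ_γ s_{λ^0/γ}({U_i : δ_i=−1}) s_{λ^h/γ}({U_i^{−1} : δ_i=1}), as an identity of formal power series. -/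

import Mathlib

open scoped BigOperators

/-- An integer partition: a weakly decreasing, finitely supported sequence of
nonnegative integers. -/
structure Ptn where
  toFun : ℕ →₀ ℕ
  antitone' : ∀ ⦃i j : ℕ⦄, i ≤ j → toFun j ≤ toFun i

namespace Ptn
/-- the `i`-th part (0-indexed) -/
def part (lam : Ptn) (i : ℕ) : ℕ := lam.toFun i
/-- the size `|λ|` -/
def size (lam : Ptn) : ℕ := lam.toFun.sum fun _ k => k
end Ptn

/-- `HStrip μ λ` means `μ ≺ λ`, i.e. `λ/μ` is a horizontal strip:
`λ_i ≥ μ_i ≥ λ_{i+1}` for all `i`. -/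
def HStrip (mu lam : Ptn) : Prop :=
  ∀ i : ℕ, mu.part i ≤ lam.part i ∧ lam.part (i + 1) ≤ mu.part i
/-- Chains of partitions `μ = c 0 ≺ c 1 ≺ ⋯` stabilizing at `λ`; these encode
semistandard Young tableaux of shape `λ/μ` with entries in `{0, 1, 2, …}`. -/
def IsSchurChain (mu lam : Ptn) (c : ℕ → Ptn) : Prop :=
  c 0 = mu ∧ (∀ i, HStrip (c i) (c (i + 1))) ∧ ∃ N, ∀ i, N ≤ i → c i = lam

/-- the monomial attached to a chain: the variable `X i` records the cells added
at step `i` of the chain -/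
noncomputable def chainWeight {R : Type*} [CommRing R] (X : ℕ → R) (c : ℕ → Ptn) : R :=
  ∏ᶠ i : ℕ, X i ^ ((c (i + 1)).size - (c i).size)

/-- the skew Schur function `s_{λ/μ}(X)` (which is `0` if `μ ⊄ λ`) -/
noncomputable def skewSchur {R : Type*} [CommRing R] [TopologicalSpace R]
    (X : ℕ → R) (lam mu : Ptn) : R :=
  ∑' c : {c : ℕ → Ptn // IsSchurChain mu lam c}, chainWeight X c.1

/-- `Ψ(X,Y) = ∏_{i,j} (1 - x_i y_j)⁻¹` -/
noncomputable def Psi {R : Type*} [CommRing R] [TopologicalSpace R] [Inv R] (X Y : ℕ → R) : R :=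
  ∏' p : ℕ × ℕ, (1 - X p.1 * Y p.2)⁻¹

/-- `Φ(X) = ∏_i (1 - x_i)⁻¹ ∏_{i<j} (1 - x_i x_j)⁻¹` -/
noncomputable def Phi {R : Type*} [CommRing R] [TopologicalSpace R] [Inv R] (X : ℕ → R) : R :=
  (∏' i : ℕ, (1 - X i)⁻¹) * ∏' p : {q : ℕ × ℕ // q.1 < q.2}, (1 - X p.1.1 * X p.1.2)⁻¹
/-- `δ` is a `±1`-profile on the indices `1, …, h` -/
def IsProfile (h : ℕ) (δ : ℕ → ℤ) : Prop := ∀ i, 1 ≤ i → i ≤ h → δ i = 1 ∨ δ i = -1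

/-- A skew doubled shifted plane partition `ω = (λ^0, …, λ^{m-1})` with profile
`(δ_1, …, δ_{m-1})`: if `δ_{i+1} = 1` then `λ^i ≺ λ^{i+1}`, and if
`δ_{i+1} = -1` then `λ^i ≻ λ^{i+1}`. -/
def IsDSPP (m : ℕ) (δ : ℕ → ℤ) (L : Fin m → Ptn) : Prop :=
  ∀ (i : ℕ) (hi : i + 1 < m),
    if δ (i + 1) = 1 then HStrip (L ⟨i, Nat.lt_of_succ_lt hi⟩) (L ⟨i + 1, hi⟩)
    else HStrip (L ⟨i + 1, hi⟩) (L ⟨i, Nat.lt_of_succ_lt hi⟩)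
/-- the coefficientwise (product) topology on multivariate formal power series -/
instance (σ : Type*) : TopologicalSpace (MvPowerSeries σ ℚ) :=
  inferInstanceAs (TopologicalSpace ((σ →₀ ℕ) → ℚ))

/-- the ambient ring: formal power series in the variables `u_0, u_1, …` -/
abbrev RU : Type := MvPowerSeries ℕ ℚ

/-- the formal variable `u_i` -/
noncomputable def u (i : ℕ) : RU := MvPowerSeries.X i

/-- `U_j = u_0 u_1 ⋯ u_{j-1}` -/
noncomputable def U (j : ℕ) : RU := ∏ t ∈ Finset.range j, u t

/-- `U_i⁻¹ U_j = u_i u_{i+1} ⋯ u_{j-1}` (for `i ≤ j`) -/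
noncomputable def Urat (i j : ℕ) : RU := ∏ t ∈ Finset.Ico i j, u t

/-- the skew Schur function `s_{λ/μ}(X)` over an arbitrary commutative ring,
for an alphabet `X` with only finitely many nonzero entries (defined by a
sum with finite support, so that no topology is needed) -/
noncomputable def skewSchurF {R : Type*} [CommRing R] (X : ℕ → R) (lam mu : Ptn) : R :=
  ∑ᶠ c : {c : ℕ → Ptn // IsSchurChain mu lam c}, chainWeight X c.1

/-- the field of fractions of `ℚ[[u_0, u_1, …]]`, in which the `U_i` are
invertible -/
abbrev KU : Type := FractionRing RU

open scoped ENNReal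

namespace Ptn

theorem ext_part {lam mu : Ptn} (h : ∀ i, lam.part i = mu.part i) : lam = mu := by
  cases lam; cases mu
  congr
  exact Finsupp.ext h

theorem toFun_injective : Function.Injective Ptn.toFun := fun _ _ h =>
  ext_part fun i => DFunLike.congr_fun h i

theorem exists_part_eq_zero (lam : Ptn) : ∃ N, ∀ i, N ≤ i → lam.part i = 0 := by
  refine ⟨lam.toFun.support.sup id + 1, fun i hi => ?_⟩
  by_contra h
  have : i ≤ lam.toFun.support.sup id :=
    Finset.le_sup (f := id) (Finsupp.mem_support_iff.2 h)
  omega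

theorem size_eq_sum_range {lam : Ptn} {N : ℕ} (h : ∀ i, N ≤ i → lam.part i = 0) :
    lam.size = ∑ i ∈ Finset.range N, lam.part i := by
  refine Finset.sum_subset (fun i hi => ?_) fun i _ hi => ?_
  · by_contra hN
    exact (Finsupp.mem_support_iff.1 hi) (h i (by simpa using hN))
  · simpa using hi

/-- The partition with prescribed parts. -/
noncomputable def ofParts (f : ℕ → ℕ) (hf : Antitone f) (h0 : ∃ N, ∀ i, N ≤ i → f i = 0) : Ptn where
  toFun := Finsupp.ofSupportFinite f <| by
    obtain ⟨N, hN⟩ := h0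
    refine (Set.finite_lt_nat N).subset fun i hi => ?_
    by_contra h
    exact hi (hN i (by simpa using h))
  antitone' := fun _ _ h => hf h

@[simp] theorem part_ofParts (f : ℕ → ℕ) (hf h0) (i : ℕ) : (ofParts f hf h0).part i = f i := rfl

end Ptn

theorem HStrip.toFun_le {mu lam : Ptn} (h : HStrip mu lam) : mu.toFun ≤ lam.toFun :=
  fun i => (h i).1

theorem HStrip.size_le {mu lam : Ptn} (h : HStrip mu lam) : mu.size ≤ lam.size := by
  obtain ⟨N, hN⟩ := lam.exists_part_eq_zero
  rw [Ptn.size_eq_sum_range hN, Ptn.size_eq_sum_range fun i hi => by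
    have := (h i).1; have := hN i hi; omega]
  exact Finset.sum_le_sum fun i _ => (h i).1

theorem HStrip.refl (lam : Ptn) : HStrip lam lam :=
  fun i => ⟨le_rfl, lam.antitone' (Nat.le_succ i)⟩

theorem HStrip.eq_of_size_eq {mu lam : Ptn} (h : HStrip mu lam) (hs : lam.size ≤ mu.size) :
    mu = lam := by
  obtain ⟨N, hN⟩ := lam.exists_part_eq_zero
  have hN' : ∀ i, N ≤ i → mu.part i = 0 := fun i hi => by
    have := (h i).1; have := hN i hi; omega
  rw [Ptn.size_eq_sum_range hN, Ptn.size_eq_sum_range hN'] at hs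
  have key := (Finset.sum_eq_sum_iff_of_le fun i (_ : i ∈ Finset.range N) => (h i).1).1
    (le_antisymm (Finset.sum_le_sum fun i _ => (h i).1) hs)
  refine Ptn.ext_part fun i => ?_
  by_cases hi : i < N
  · exact key i (by simpa using hi)
  · rw [hN i (by omega), hN' i (by omega)]

theorem Ptn.finite_le (lam : Ptn) : {mu : Ptn | mu.toFun ≤ lam.toFun}.Finite :=
  (Set.finite_Iic lam.toFun).preimage Ptn.toFun_injective.injOn

/-- The partitions `μ` with `μ ≺ λ`. -/
noncomputable def below (lam : Ptn) : Finset Ptn :=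
  (lam.finite_le.subset (t := {mu | HStrip mu lam}) fun _ h => HStrip.toFun_le h).toFinset

@[simp] theorem mem_below {mu lam : Ptn} : mu ∈ below lam ↔ HStrip mu lam := by
  simp [below]

/-- The parts of `reflectUp`. -/
def reflectUpPart (α β μ : Ptn) (k : ℕ) : ℕ → ℕ
  | 0 => max (α.part 0) (β.part 0) + k
  | i + 1 => min (α.part i) (β.part i) + max (α.part (i + 1)) (β.part (i + 1)) - μ.part i

/-- The partition obtained from a common lower neighbour `μ` of `α`, `β` by reflecting each part in
its allowed interval, with excess `k` in the first row. -/
noncomputable def reflectUp (α β μ : Ptn) (k : ℕ) (hα : HStrip μ α) (hβ : HStrip μ β) : Ptn :=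
  Ptn.ofParts
    (reflectUpPart α β μ k)
    (antitone_nat_of_succ_le fun i => by
      have h1 := hα i; have h2 := hβ i
      cases i with
      | zero => simp only [reflectUpPart]; omega
      | succ i => have h3 := hα i; have h4 := hβ i; simp only [reflectUpPart]; omega)
    (by
      obtain ⟨N, hN⟩ := α.exists_part_eq_zero
      obtain ⟨M, hM⟩ := β.exists_part_eq_zero
      refine ⟨N + M + 1, fun i hi => ?_⟩
      obtain ⟨i, rfl⟩ : ∃ j, i = j + 1 := ⟨i - 1, by omega⟩
      have := hN i (by omega); have := hN (i + 1) (by omega)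
      have := hM i (by omega); have := hM (i + 1) (by omega)
      simp only [reflectUpPart]; omega)

/-- The partition obtained from a common upper neighbour `λ` of `α`, `β` by reflecting each part
but the first in its allowed interval. -/
noncomputable def reflectDown (α β lam : Ptn) (hα : HStrip α lam) (hβ : HStrip β lam) : Ptn :=
  Ptn.ofParts
    (fun i => min (α.part i) (β.part i) + max (α.part (i + 1)) (β.part (i + 1)) - lam.part (i + 1))
    (antitone_nat_of_succ_le fun i => by
      have h1 := hα i; have h2 := hβ i; have h3 := hα (i + 1); have h4 := hβ (i + 1)
      have h5 := hα (i + 1 + 1); have h6 := hβ (i + 1 + 1)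
      omega)
    (by
      obtain ⟨N, hN⟩ := α.exists_part_eq_zero
      obtain ⟨M, hM⟩ := β.exists_part_eq_zero
      refine ⟨N + M, fun i hi => ?_⟩
      have := hN i (by omega); have := hN (i + 1) (by omega)
      have := hM i (by omega); have := hM (i + 1) (by omega)
      omega)

/-- Common upper neighbours of `α`, `β` correspond to common lower neighbours together with a
natural number. -/
noncomputable def upperEquiv (α β : Ptn) :
    {lam : Ptn // HStrip α lam ∧ HStrip β lam} ≃ ℕ × {mu : Ptn // HStrip mu α ∧ HStrip mu β} where
  toFun lam := (lam.1.part 0 - max (α.part 0) (β.part 0),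
    ⟨reflectDown α β lam.1 lam.2.1 lam.2.2, by
      constructor <;> intro i <;>
      · have h1 := lam.2.1 i; have h2 := lam.2.2 i
        have h3 := lam.2.1 (i + 1); have h4 := lam.2.2 (i + 1)
        simp only [reflectDown, Ptn.part_ofParts]; omega⟩)
  invFun p := ⟨reflectUp α β p.2.1 p.1 p.2.2.1 p.2.2.2, by
      constructor <;> intro i <;>
      · have h1 := p.2.2.1 i; have h2 := p.2.2.2 i
        cases i with
        | zero => simp only [reflectUp, reflectUpPart, Ptn.part_ofParts]; omega
        | succ i =>
          have h3 := p.2.2.1 i; have h4 := p.2.2.2 i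
          simp only [reflectUp, reflectUpPart, Ptn.part_ofParts]; omega⟩
  left_inv lam := by
    refine Subtype.ext (Ptn.ext_part fun i => ?_)
    cases i with
    | zero =>
      have h1 := lam.2.1 0; have h2 := lam.2.2 0
      simp only [reflectUp, reflectUpPart, Ptn.part_ofParts]; omega
    | succ i =>
      have h1 := lam.2.1 i; have h2 := lam.2.2 i
      have h3 := lam.2.1 (i + 1); have h4 := lam.2.2 (i + 1)
      simp only [reflectUp, reflectUpPart, reflectDown, Ptn.part_ofParts]; omega
  right_inv p := by
    refine Prod.ext ?_ (Subtype.ext (Ptn.ext_part fun i => ?_))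
    · simp [reflectUp, reflectUpPart]
    · have h1 := p.2.2.1 i; have h2 := p.2.2.2 i
      simp only [reflectUp, reflectUpPart, reflectDown, Ptn.part_ofParts]; omega

theorem size_upperEquiv_symm (α β : Ptn) (p : ℕ × {mu : Ptn // HStrip mu α ∧ HStrip mu β}) :
    ((upperEquiv α β).symm p).1.size + p.2.1.size = α.size + β.size + p.1 := by
  obtain ⟨N, hN⟩ := α.exists_part_eq_zero
  obtain ⟨M, hM⟩ := β.exists_part_eq_zero
  set L := ((upperEquiv α β).symm p).1 with hL
  have hLs : ∀ i, L.part (i + 1) + p.2.1.part i =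
      min (α.part i) (β.part i) + max (α.part (i + 1)) (β.part (i + 1)) := fun i => by
    have h1 := p.2.2.1 i; have h2 := p.2.2.2 i
    simp only [hL, upperEquiv, Equiv.coe_fn_symm_mk, reflectUp, reflectUpPart, Ptn.part_ofParts]; omega
  have hL0 : L.part 0 = max (α.part 0) (β.part 0) + p.1 := rfl
  rw [Ptn.size_eq_sum_range (N := N + M + 1) (lam := L) fun i hi => by
      obtain ⟨i, rfl⟩ : ∃ j, i = j + 1 := ⟨i - 1, by omega⟩
      have := hLs i
      have := hN i (by omega); have := hN (i + 1) (by omega)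
      have := hM i (by omega); have := hM (i + 1) (by omega)
      omega,
    Ptn.size_eq_sum_range (N := N + M) (lam := p.2.1) fun i hi => by
      have := (p.2.2.1 i).1; have := hN i (by omega); omega,
    Ptn.size_eq_sum_range (N := N + M) (lam := α) fun i hi => hN i (by omega),
    Ptn.size_eq_sum_range (N := N + M) (lam := β) fun i hi => hM i (by omega),
    Finset.sum_range_succ', add_right_comm, ← Finset.sum_add_distrib,
    Finset.sum_congr rfl fun i _ => hLs i, hL0]
  rw [Finset.sum_add_distrib]
  have htel := Finset.sum_range_succ' (fun i => max (α.part i) (β.part i)) (N + M)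
  rw [Finset.sum_range_succ, hN (N + M) (by omega), hM (N + M) (by omega)] at htel
  have hmm : ∑ i ∈ Finset.range (N + M), α.part i + ∑ i ∈ Finset.range (N + M), β.part i =
      ∑ i ∈ Finset.range (N + M), min (α.part i) (β.part i) +
        ∑ i ∈ Finset.range (N + M), max (α.part i) (β.part i) := by
    rw [← Finset.sum_add_distrib, ← Finset.sum_add_distrib]
    exact Finset.sum_congr rfl fun i _ => (min_add_max _ _).symm
  simp only [max_self] at htel ⊢
  omega

theorem tsum_ite_eq_tsum_subtype {ι : Type*} (p : ι → Prop) [DecidablePred p] (f : ι → ℝ≥0∞) :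
    ∑' i, (if p i then f i else 0) = ∑' i : {i // p i}, f i := by
  classical
  refine Eq.trans (tsum_congr fun i => ?_) (tsum_subtype {i | p i} f).symm
  simp [Set.indicator_apply]

open Classical in
/-- Commutation of adding and removing a horizontal strip. -/
theorem tsum_upper_eq_tsum_lower (α β : Ptn) (f : ℕ → ℝ≥0∞) :
    ∑' lam : Ptn, (if HStrip α lam ∧ HStrip β lam then f lam.size else 0) =
      ∑' k : ℕ, ∑' mu : Ptn,
        if HStrip mu α ∧ HStrip mu β then f (α.size + β.size + k - mu.size) else 0 := by
  rw [tsum_ite_eq_tsum_subtype (fun lam : Ptn => HStrip α lam ∧ HStrip β lam)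
      fun lam : Ptn => f lam.size,
    ← (upperEquiv α β).symm.tsum_eq, ENNReal.tsum_prod']
  refine tsum_congr fun k => ?_
  rw [tsum_ite_eq_tsum_subtype (fun mu : Ptn => HStrip mu α ∧ HStrip mu β)
    fun mu : Ptn => f (α.size + β.size + k - mu.size)]
  refine tsum_congr fun mu => ?_
  rw [← size_upperEquiv_symm α β (k, mu), Nat.add_sub_cancel]

/-- The upper end of the interval allowed for a part of `μ` when `α ≺ μ ≺ β`. -/
def midUpper (α β : Ptn) : ℕ → ℕ
  | 0 => β.part 0
  | j + 1 => min (β.part (j + 1)) (α.part j)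

/-- The Bender–Knuth reflection of `μ` inside the interval `α ≺ μ ≺ β`. -/
noncomputable def reflectMid (α β μ : Ptn) (hα : HStrip α μ) (hβ : HStrip μ β) : Ptn :=
  Ptn.ofParts
    (fun i => max (α.part i) (β.part (i + 1)) +
      midUpper α β i - μ.part i)
    (antitone_nat_of_succ_le fun i => by
      have h1 := hα i; have h2 := hβ i; have h3 := hα (i + 1); have h4 := hβ (i + 1)
      cases i with
      | zero => simp only [midUpper]; omega
      | succ i => have h5 := hα i; have h6 := hβ i; simp only [midUpper]; omega)
    (by
      obtain ⟨N, hN⟩ := β.exists_part_eq_zero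
      refine ⟨N + 1, fun i hi => ?_⟩
      obtain ⟨i, rfl⟩ : ∃ j, i = j + 1 := ⟨i - 1, by omega⟩
      have := hN (i + 1) (by omega); have := hN (i + 1 + 1) (by omega)
      have := (hα (i + 1)).1; have := (hβ (i + 1)).1
      simp only [midUpper]; omega)

theorem reflectMid_spec (α β μ : Ptn) (hα : HStrip α μ) (hβ : HStrip μ β) :
    HStrip α (reflectMid α β μ hα hβ) ∧ HStrip (reflectMid α β μ hα hβ) β := by
  constructor <;> intro i <;>
  · have h1 := hα i; have h2 := hβ i; have h3 := hα (i + 1); have h4 := hβ (i + 1)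
    cases i with
    | zero => simp only [reflectMid, midUpper, Ptn.part_ofParts]; omega
    | succ i =>
      have h5 := hα i; have h6 := hβ i
      simp only [reflectMid, midUpper, Ptn.part_ofParts]; omega

theorem reflectMid_reflectMid (α β μ : Ptn) (hα : HStrip α μ) (hβ : HStrip μ β) :
    reflectMid α β (reflectMid α β μ hα hβ) (reflectMid_spec α β μ hα hβ).1
      (reflectMid_spec α β μ hα hβ).2 = μ := by
  refine Ptn.ext_part fun i => ?_
  have h1 := hα i; have h2 := hβ i
  cases i with
  | zero => simp only [reflectMid, midUpper, Ptn.part_ofParts]; omega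
  | succ i =>
    have h5 := hα i; have h6 := hβ i
    simp only [reflectMid, midUpper, Ptn.part_ofParts]; omega

theorem size_reflectMid (α β μ : Ptn) (hα : HStrip α μ) (hβ : HStrip μ β) :
    (reflectMid α β μ hα hβ).size + μ.size = α.size + β.size := by
  obtain ⟨N, hN⟩ := β.exists_part_eq_zero
  have hμN : ∀ i, N ≤ i → μ.part i = 0 := fun i hi => by
    have := (hβ i).1; have := hN i hi; omega
  have hαN : ∀ i, N ≤ i → α.part i = 0 := fun i hi => by
    have := (hα i).1; have := hμN i hi; omega
  have hR := reflectMid_spec α β μ hα hβ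
  have hR0 : (reflectMid α β μ hα hβ).part 0 + μ.part 0 =
      max (α.part 0) (β.part (0 + 1)) + β.part 0 := by
    have h1 := hα 0; have h2 := hβ 0
    simp only [reflectMid, midUpper, Ptn.part_ofParts]; omega
  have hRs : ∀ i, (reflectMid α β μ hα hβ).part (i + 1) + μ.part (i + 1) =
      max (α.part (i + 1)) (β.part (i + 1 + 1)) + min (β.part (i + 1)) (α.part i) := fun i => by
    have h1 := hα i; have h2 := hβ i; have h3 := hα (i + 1); have h4 := hβ (i + 1)
    simp only [reflectMid, midUpper, Ptn.part_ofParts]; omega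
  rw [Ptn.size_eq_sum_range (N := N + 1) (lam := reflectMid α β μ hα hβ) fun i hi => by
      have := (hR.2 i).1; have := hN i (by omega); omega,
    Ptn.size_eq_sum_range (N := N + 1) (lam := μ) fun i hi => hμN i (by omega),
    Ptn.size_eq_sum_range (N := N) (lam := α) fun i hi => hαN i (by omega),
    Ptn.size_eq_sum_range (N := N + 1) (lam := β) fun i hi => hN i (by omega),
    ← Finset.sum_add_distrib, Finset.sum_range_succ', Finset.sum_congr rfl fun i _ => hRs i, hR0,
    Finset.sum_range_succ' _ N, Finset.sum_add_distrib]
  have htel := Finset.sum_range_succ' (fun i => max (α.part i) (β.part (i + 1))) N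
  rw [Finset.sum_range_succ, hαN N le_rfl, hN (N + 1) (by omega)] at htel
  have hmm : ∑ i ∈ Finset.range N, α.part i + ∑ i ∈ Finset.range N, β.part (i + 1) =
      ∑ i ∈ Finset.range N, min (β.part (i + 1)) (α.part i) +
        ∑ i ∈ Finset.range N, max (α.part i) (β.part (i + 1)) := by
    rw [← Finset.sum_add_distrib, ← Finset.sum_add_distrib]
    exact Finset.sum_congr rfl fun i _ => by omega
  simp only [max_self, zero_add] at htel ⊢
  omega

open Classical in
/-- The Bender–Knuth symmetry. -/
theorem tsum_between_reflect (α β : Ptn) (f : ℕ → ℝ≥0∞) :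
    ∑' mu : Ptn, (if HStrip α mu ∧ HStrip mu β then f mu.size else 0) =
      ∑' mu : Ptn, if HStrip α mu ∧ HStrip mu β then f (α.size + β.size - mu.size) else 0 := by
  rw [tsum_ite_eq_tsum_subtype (fun mu : Ptn => HStrip α mu ∧ HStrip mu β)
      fun mu : Ptn => f mu.size,
    tsum_ite_eq_tsum_subtype (fun mu : Ptn => HStrip α mu ∧ HStrip mu β)
      fun mu : Ptn => f (α.size + β.size - mu.size)]
  let e : {mu : Ptn // HStrip α mu ∧ HStrip mu β} → {mu : Ptn // HStrip α mu ∧ HStrip mu β} :=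
    fun mu => ⟨reflectMid α β mu.1 mu.2.1 mu.2.2, reflectMid_spec α β mu.1 mu.2.1 mu.2.2⟩
  have he : Function.Involutive e := fun mu =>
    Subtype.ext (reflectMid_reflectMid α β mu.1 mu.2.1 mu.2.2)
  rw [← (he.toPerm e).tsum_eq]
  refine tsum_congr fun mu => ?_
  rw [← size_reflectMid α β mu.1 mu.2.1 mu.2.2, Nat.add_sub_cancel]
  rfl

section WeightedSums

variable {K : Type*}

/-- The total value of `φ` over a multiset of weights. -/
noncomputable def wsum (M : Multiset K) (φ : K → ℝ≥0∞) : ℝ≥0∞ := (M.map φ).sum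

theorem wsum_tsum {ι : Type*} (M : Multiset K) (f : ι → K → ℝ≥0∞) :
    wsum M (fun z => ∑' i, f i z) = ∑' i, wsum M (f i) := by
  induction M using Multiset.induction_on with
  | empty => simp [wsum]
  | cons a M ih =>
    simp only [wsum, Multiset.map_cons, Multiset.sum_cons] at ih ⊢
    rw [ih, ENNReal.tsum_add]

theorem wsum_ite (M : Multiset K) (P : Prop) [Decidable P] (f : K → ℝ≥0∞) :
    wsum M (fun z => if P then f z else 0) = if P then wsum M f else 0 := by
  split_ifs <;> simp [wsum]

theorem wsum_finset_sum {ι : Type*} (s : Finset ι) (M : ι → Multiset K) (f : K → ℝ≥0∞) :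
    wsum (∑ i ∈ s, M i) f = ∑ i ∈ s, wsum (M i) f := by
  classical
  induction s using Finset.induction_on with
  | empty => simp [wsum]
  | insert i s hi ih =>
    rw [Finset.sum_insert hi, Finset.sum_insert hi, ← ih]
    simp [wsum]

variable [CommMonoid K]

/-- The operator on test functions dual to multiplication by `1 / (1 - r)`. -/
noncomputable def geo (r : K) (φ : K → ℝ≥0∞) (z : K) : ℝ≥0∞ := ∑' k : ℕ, φ (z * r ^ k)

/-- The operator on test functions dual to multiplication by `∏ 1 / (1 - r)`. -/
noncomputable def geoList : List K → (K → ℝ≥0∞) → K → ℝ≥0∞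
  | [], φ => φ
  | r :: l, φ => geo r (geoList l φ)

theorem geoList_append (l m : List K) (φ : K → ℝ≥0∞) :
    geoList (l ++ m) φ = geoList l (geoList m φ) := by
  induction l with
  | nil => rfl
  | cons r l ih => simp [geoList, ih]

theorem geoList_mul_right (l : List K) (φ : K → ℝ≥0∞) (c z : K) :
    geoList l (fun w => φ (w * c)) z = geoList l φ (z * c) := by
  induction l generalizing z with
  | nil => rfl
  | cons r l ih => simp only [geoList, geo, ih, mul_right_comm]

theorem geoList_cons_eq_add (r : K) (l : List K) (φ : K → ℝ≥0∞) (z : K) :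
    geoList (r :: l) φ z = geoList l φ z + geoList (r :: l) (fun w => φ (w * r)) z := by
  rw [geoList_mul_right]
  refine (tsum_eq_zero_add' (f := fun k : ℕ => geoList l φ (z * r ^ k)) ENNReal.summable).trans ?_
  simp only [pow_zero, mul_one, geoList, geo, pow_succ', mul_assoc]

theorem le_geoList (l : List K) (φ : K → ℝ≥0∞) (z : K) : φ z ≤ geoList l φ z := by
  induction l with
  | nil => exact le_rfl
  | cons r l ih => exact ih.trans ((geoList_cons_eq_add r l φ z).symm ▸ le_self_add)

end WeightedSums

section Chains

variable {K : Type*} [CommMonoid K]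

open Classical in
/-- The weights of the chains of `n` horizontal strips from `γ` to `λ` that are trivial at the
steps not satisfying `p`. -/
noncomputable def chainWeights (p : ℕ → Prop) (x : ℕ → K) : ℕ → Ptn → Ptn → Multiset K
  | 0, γ, lam => if γ = lam then {1} else 0
  | n + 1, γ, lam =>
    if p n then ∑ c ∈ below lam, (chainWeights p x n γ c).map (· * x n ^ (lam.size - c.size))
    else chainWeights p x n γ lam

open Classical in
theorem wsum_chainWeights_zero (p : ℕ → Prop) (x : ℕ → K) (γ lam : Ptn) (φ : K → ℝ≥0∞) :
    wsum (chainWeights p x 0 γ lam) φ = if γ = lam then φ 1 else 0 := by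
  rw [chainWeights]
  split_ifs <;> simp [wsum]

theorem chainWeights_succ_of_not {p : ℕ → Prop} {n : ℕ} (hn : ¬ p n) (x : ℕ → K) (γ lam : Ptn) :
    chainWeights p x (n + 1) γ lam = chainWeights p x n γ lam := by
  rw [chainWeights, if_neg hn]

open Classical in
theorem wsum_chainWeights_succ {p : ℕ → Prop} {n : ℕ} (hn : p n) (x : ℕ → K) (γ lam : Ptn)
    (φ : K → ℝ≥0∞) :
    wsum (chainWeights p x (n + 1) γ lam) φ = ∑' c : Ptn, if HStrip c lam then
      wsum (chainWeights p x n γ c) (fun z => φ (z * x n ^ (lam.size - c.size))) else 0 := by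
  rw [chainWeights, if_pos hn, wsum_finset_sum,
    tsum_eq_sum (s := below lam) fun c hc => if_neg (by simpa using hc)]
  refine Finset.sum_congr rfl fun c hc => ?_
  rw [if_pos (by simpa using hc)]
  simp [wsum]

theorem chainWeights_toFun_le {p : ℕ → Prop} {x : ℕ → K} {n : ℕ} {γ lam : Ptn}
    (h : chainWeights p x n γ lam ≠ 0) : γ.toFun ≤ lam.toFun := by
  induction n generalizing lam with
  | zero =>
    rw [chainWeights] at h
    split_ifs at h with h'
    · rw [h']
    · exact absurd rfl h
  | succ n ih =>
    rw [chainWeights] at h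
    split_ifs at h
    · obtain ⟨c, hc, h'⟩ := Finset.exists_ne_zero_of_sum_ne_zero h
      exact (ih fun h0 => h' (by simp [h0])).trans (mem_below.1 hc).toFun_le
    · exact ih h

open Classical in
/-- The products `x q * y` over `q < n` with `p q`. -/
noncomputable def crossRatios (p : ℕ → Prop) (x : ℕ → K) (y : K) : ℕ → List K
  | 0 => []
  | n + 1 => if p n then (x n * y) :: crossRatios p x y n else crossRatios p x y n

theorem ite_tsum {ι : Type*} (P : Prop) [Decidable P] (f : ι → ℝ≥0∞) :
    (if P then ∑' i, f i else 0) = ∑' i, if P then f i else 0 := by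
  split_ifs <;> simp

open Classical in
/-- Removing a horizontal strip after a chain of added strips. -/
theorem tsum_chainWeights_upper (p : ℕ → Prop) (x : ℕ → K) (y : K) (n : ℕ) (γ ν : Ptn)
    (φ : K → ℝ≥0∞) :
    ∑' lam : Ptn, (if HStrip ν lam then
        wsum (chainWeights p x n γ lam) (fun z => φ (z * y ^ (lam.size - ν.size))) else 0) =
      ∑' κ : Ptn, if HStrip κ γ then wsum (chainWeights p x n κ ν)
        (fun z => geoList (crossRatios p x y n) φ (z * y ^ (γ.size - κ.size))) else 0 := by
  induction n generalizing ν φ with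
  | zero =>
    rw [tsum_eq_single γ fun lam h => by rw [wsum_chainWeights_zero, if_neg h.symm, ite_self],
      tsum_eq_single ν fun κ h => by rw [wsum_chainWeights_zero, if_neg h, ite_self]]
    simp [wsum_chainWeights_zero, crossRatios, geoList]
  | succ n ih =>
    by_cases hn : p n
    · have hR : crossRatios p x y (n + 1) = (x n * y) :: crossRatios p x y n := by
        rw [crossRatios, if_pos hn]
      calc
        _ = ∑' c : Ptn, ∑' lam : Ptn, if HStrip c lam ∧ HStrip ν lam then
              (fun m => wsum (chainWeights p x n γ c)
                fun z => φ (z * x n ^ (m - c.size) * y ^ (m - ν.size))) lam.size else 0 := by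
          rw [ENNReal.tsum_comm]
          refine tsum_congr fun lam => ?_
          rw [wsum_chainWeights_succ hn, ite_tsum]
          refine tsum_congr fun c => ?_
          by_cases h1 : HStrip ν lam <;> by_cases h2 : HStrip c lam <;> simp [h1, h2]
        _ = ∑' c : Ptn, ∑' k : ℕ, ∑' μ : Ptn, if HStrip μ c ∧ HStrip μ ν then
              wsum (chainWeights p x n γ c) (fun z => φ (z * y ^ (c.size - μ.size) *
                (x n ^ (ν.size - μ.size) * (x n * y) ^ k))) else 0 := by
          refine tsum_congr fun c => ?_
          refine (tsum_upper_eq_tsum_lower c ν fun m => wsum (chainWeights p x n γ c)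
            fun z => φ (z * x n ^ (m - c.size) * y ^ (m - ν.size))).trans ?_
          refine tsum_congr fun k => tsum_congr fun μ => ?_
          split_ifs with h
          · have h1 := h.1.size_le
            have h2 := h.2.size_le
            congr 1
            ext z
            rw [show c.size + ν.size + k - μ.size - c.size = (ν.size - μ.size) + k by omega,
              show c.size + ν.size + k - μ.size - ν.size = (c.size - μ.size) + k by omega,
              pow_add, pow_add, mul_pow]
            congr 1
            simp only [mul_assoc, mul_comm, mul_left_comm]
          · rfl
        _ = ∑' μ : Ptn, ∑' k : ℕ, if HStrip μ ν then ∑' c : Ptn, (if HStrip μ c then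
              wsum (chainWeights p x n γ c) (fun z => φ (z * y ^ (c.size - μ.size) *
                (x n ^ (ν.size - μ.size) * (x n * y) ^ k))) else 0) else 0 := by
          refine ENNReal.tsum_comm.trans (Eq.trans ?_ ENNReal.tsum_comm)
          refine tsum_congr fun k => ?_
          rw [ENNReal.tsum_comm]
          refine tsum_congr fun μ => ?_
          rw [ite_tsum]
          refine tsum_congr fun c => ?_
          by_cases h1 : HStrip μ c <;> by_cases h2 : HStrip μ ν <;> simp [h1, h2]
        _ = ∑' μ : Ptn, ∑' k : ℕ, ∑' κ : Ptn, if HStrip μ ν ∧ HStrip κ γ then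
              wsum (chainWeights p x n κ μ) (fun z => geoList (crossRatios p x y n) φ
                (z * y ^ (γ.size - κ.size) * (x n ^ (ν.size - μ.size) * (x n * y) ^ k)))
              else 0 := by
          refine tsum_congr fun μ => tsum_congr fun k => ?_
          rw [ih μ fun w => φ (w * (x n ^ (ν.size - μ.size) * (x n * y) ^ k)), ite_tsum]
          refine tsum_congr fun κ => ?_
          simp only [geoList_mul_right]
          by_cases h1 : HStrip μ ν <;> by_cases h2 : HStrip κ γ <;> simp [h1, h2]
        _ = _ := by
          rw [tsum_congr fun μ => ENNReal.tsum_comm, ENNReal.tsum_comm]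
          refine tsum_congr fun κ => ?_
          rw [wsum_chainWeights_succ hn, ite_tsum]
          refine tsum_congr fun μ => ?_
          simp only [hR, geoList, geo]
          rw [wsum_tsum, ite_tsum, ite_tsum]
          refine tsum_congr fun k => ?_
          by_cases h1 : HStrip μ ν <;> by_cases h2 : HStrip κ γ <;> simp [h1, h2]
          congr 1
          ext z
          congr 1
          simp only [mul_assoc, mul_comm, mul_left_comm]
    · simp only [chainWeights_succ_of_not hn, crossRatios, if_neg hn]
      exact ih ν φ

open Classical in
/-- A strip added at the inside of a chain can be added at the outside instead. -/
theorem tsum_chainWeights_inner (p : ℕ → Prop) (x : ℕ → K) (y : K) (n : ℕ) (κ a : Ptn)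
    (φ : K → ℝ≥0∞) :
    ∑' γ : Ptn, (if HStrip κ γ then
        wsum (chainWeights p x n γ a) (fun z => φ (z * y ^ (γ.size - κ.size))) else 0) =
      ∑' c : Ptn, if HStrip c a then
        wsum (chainWeights p x n κ c) (fun z => φ (z * y ^ (a.size - c.size))) else 0 := by
  induction n generalizing a φ with
  | zero =>
    rw [tsum_eq_single a fun lam h => by rw [wsum_chainWeights_zero, if_neg h, ite_self],
      tsum_eq_single κ fun κ h => by rw [wsum_chainWeights_zero, if_neg h.symm, ite_self]]
    simp [wsum_chainWeights_zero]
  | succ n ih =>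
    by_cases hn : p n
    · calc
        _ = ∑' c : Ptn, if HStrip c a then ∑' γ : Ptn, (if HStrip κ γ then
              wsum (chainWeights p x n γ c)
                (fun z => φ (z * y ^ (γ.size - κ.size) * x n ^ (a.size - c.size))) else 0)
              else 0 := by
          rw [tsum_congr fun c => ite_tsum _ _, ENNReal.tsum_comm]
          refine tsum_congr fun γ => ?_
          rw [wsum_chainWeights_succ hn, ite_tsum]
          refine tsum_congr fun c => ?_
          simp only [mul_right_comm]
          by_cases h1 : HStrip κ γ <;> by_cases h2 : HStrip c a <;> simp [h1, h2]
        _ = ∑' c : Ptn, ∑' d : Ptn, if HStrip d c ∧ HStrip c a then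
              (fun m => wsum (chainWeights p x n κ d)
                (fun z => φ (z * y ^ (m - d.size) * x n ^ (a.size - m)))) c.size else 0 := by
          refine tsum_congr fun c => ?_
          rw [ih c fun z => φ (z * x n ^ (a.size - c.size)), ite_tsum]
          refine tsum_congr fun d => ?_
          by_cases h1 : HStrip d c <;> by_cases h2 : HStrip c a <;> simp [h1, h2]
        _ = ∑' c : Ptn, ∑' d : Ptn, if HStrip d c ∧ HStrip c a then
              wsum (chainWeights p x n κ d)
                (fun z => φ (z * x n ^ (c.size - d.size) * y ^ (a.size - c.size))) else 0 := by
          refine ENNReal.tsum_comm.trans (Eq.trans ?_ ENNReal.tsum_comm)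
          refine tsum_congr fun d => ?_
          refine (tsum_between_reflect d a fun m => wsum (chainWeights p x n κ d)
            fun z => φ (z * y ^ (m - d.size) * x n ^ (a.size - m))).trans ?_
          refine tsum_congr fun c => ?_
          split_ifs with h
          · have h1 := h.1.size_le
            have h2 := h.2.size_le
            congr 1
            ext z
            rw [show d.size + a.size - c.size - d.size = a.size - c.size by omega,
              show a.size - (d.size + a.size - c.size) = c.size - d.size by omega,
              mul_right_comm]
          · rfl
        _ = _ := by
          refine tsum_congr fun c => ?_
          rw [wsum_chainWeights_succ hn, ite_tsum]
          refine tsum_congr fun d => ?_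
          by_cases h1 : HStrip d c <;> by_cases h2 : HStrip c a <;> simp [h1, h2]
    · simp only [chainWeights_succ_of_not hn]
      exact ih a φ

open Classical in
/-- The weighted sum over the sequences of partitions from `a` to `b` that go up at the steps
satisfying `up` and down at the others. -/
noncomputable def walkSum (up : ℕ → Prop) (x : ℕ → K) : ℕ → Ptn → Ptn → (K → ℝ≥0∞) → ℝ≥0∞
  | 0, a, b, φ => if a = b then φ 1 else 0
  | n + 1, a, b, φ =>
    if up n then ∑' c : Ptn, if HStrip c b then
      walkSum up x n a c (fun z => φ (z * x n ^ (b.size - c.size))) else 0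
    else ∑' c : Ptn, if HStrip b c then
      walkSum up x n a c (fun z => φ (z * x n ^ (c.size - b.size))) else 0

open Classical in
/-- The products `x i * x j` over `i < j < n` with an upward step at `i` and a downward one at `j`. -/
noncomputable def inversionRatios (up : ℕ → Prop) (x : ℕ → K) : ℕ → List K
  | 0 => []
  | n + 1 => if up n then inversionRatios up x n
    else crossRatios up x (x n) n ++ inversionRatios up x n

open Classical in
theorem walkSum_eq (up : ℕ → Prop) (x : ℕ → K) (n : ℕ) (a b : Ptn) (φ : K → ℝ≥0∞) :
    walkSum up x n a b φ = ∑' γ : Ptn, wsum (chainWeights (fun i => ¬ up i) x n γ a) fun z =>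
      wsum (chainWeights up x n γ b) fun w => geoList (inversionRatios up x n) φ (z * w) := by
  induction n generalizing b φ with
  | zero =>
    simp only [wsum_chainWeights_zero, walkSum, inversionRatios, geoList]
    rw [tsum_eq_single a fun γ h => if_neg h]
    simp
  | succ n ih =>
    by_cases hn : up n
    · rw [walkSum, if_pos hn]
      simp only [ih, ite_tsum, inversionRatios, if_pos hn]
      rw [ENNReal.tsum_comm]
      refine tsum_congr fun γ => ?_
      rw [chainWeights_succ_of_not (not_not.2 hn)]
      simp only [wsum_chainWeights_succ hn, wsum_tsum, wsum_ite, geoList_mul_right, mul_assoc]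
    · rw [walkSum, if_neg hn]
      simp only [ih, inversionRatios, if_neg hn, geoList_append, geoList_mul_right]
      set ψ := geoList (inversionRatios up x n) φ
      calc
        _ = ∑' γ : Ptn, wsum (chainWeights (fun i => ¬ up i) x n γ a) (fun z =>
              ∑' c : Ptn, if HStrip b c then wsum (chainWeights up x n γ c)
                (fun w => (fun w => ψ (z * w)) (w * x n ^ (c.size - b.size))) else 0) := by
          simp only [wsum_tsum, wsum_ite, ite_tsum, mul_assoc]
          rw [ENNReal.tsum_comm]
        _ = ∑' γ : Ptn, ∑' κ : Ptn, if HStrip κ γ then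
              wsum (chainWeights (fun i => ¬ up i) x n γ a) (fun z =>
                (fun z => wsum (chainWeights up x n κ b)
                  (fun w => geoList (crossRatios up x (x n) n) ψ (z * w)))
                (z * x n ^ (γ.size - κ.size))) else 0 := by
          refine tsum_congr fun γ => ?_
          refine (congrArg (wsum _) (funext fun z =>
            tsum_chainWeights_upper up x (x n) n γ b fun w => ψ (z * w))).trans ?_
          simp only [wsum_tsum, wsum_ite]
          refine tsum_congr fun κ => ?_
          split_ifs
          · congr 1
            ext z
            congr 1
            ext w
            have := geoList_mul_right (crossRatios up x (x n) n) ψ z (w * x n ^ (γ.size - κ.size))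
            simp only [mul_comm z] at this ⊢
            rw [this]
            congr 1
            simp only [mul_comm, mul_left_comm]
          · rfl
        _ = _ := by
          rw [ENNReal.tsum_comm]
          refine tsum_congr fun κ => ?_
          rw [tsum_chainWeights_inner (fun i => ¬ up i) x (x n) n κ a fun z =>
              wsum (chainWeights up x n κ b)
                (fun w => geoList (crossRatios up x (x n) n) ψ (z * w)),
            wsum_chainWeights_succ (p := fun i => ¬ up i) hn, chainWeights_succ_of_not hn]

end Chains

section SkewSchur

variable {R : Type*} [CommRing R]

/-- The chains of `n` horizontal strips from `γ` to `λ`, trivial at the steps not satisfying `p`,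
prolonged by the constant `λ`. -/
def chainSet (p : ℕ → Prop) (n : ℕ) (γ lam : Ptn) : Set (ℕ → Ptn) :=
  {c | c 0 = γ ∧ (∀ i, HStrip (c i) (c (i + 1))) ∧ (∀ i, ¬ (i < n ∧ p i) → c (i + 1) = c i) ∧
    c n = lam}

open Classical in
/-- The weight of a chain in `chainSet p n γ λ`. -/
noncomputable def stepWeight (p : ℕ → Prop) (x : ℕ → R) (n : ℕ) (c : ℕ → Ptn) : R :=
  ∏ i ∈ Finset.range n, if p i then x i ^ ((c (i + 1)).size - (c i).size) else 1

theorem eq_of_constant_from {α : Type*} {c : ℕ → α} {n : ℕ} (h : ∀ i, n ≤ i → c (i + 1) = c i)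
    {i : ℕ} (hi : n ≤ i) : c i = c n := by
  induction i, hi using Nat.le_induction with
  | base => rfl
  | succ i hi ih => rw [h i hi, ih]

theorem chainSet_zero (p : ℕ → Prop) (γ lam : Ptn) :
    chainSet p 0 γ lam = {c | γ = lam ∧ c = fun _ => γ} := by
  ext c
  constructor
  · rintro ⟨h0, -, h1, h2⟩
    exact ⟨h0.symm.trans h2, funext fun i =>
      (eq_of_constant_from (fun i _ => h1 i (by simp)) (Nat.zero_le i)).trans h0⟩
  · rintro ⟨rfl, rfl⟩
    exact ⟨rfl, fun i => HStrip.refl _, fun _ _ => rfl, rfl⟩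

theorem chainSet_succ_of_not {p : ℕ → Prop} {n : ℕ} (hn : ¬ p n) (γ lam : Ptn) :
    chainSet p (n + 1) γ lam = chainSet p n γ lam := by
  have key : ∀ i, (i < n + 1 ∧ p i) ↔ (i < n ∧ p i) := fun i =>
    ⟨fun h => ⟨lt_of_le_of_ne (Nat.lt_succ_iff.1 h.1) fun e => hn (e ▸ h.2), h.2⟩,
      fun h => ⟨h.1.trans (Nat.lt_succ_self n), h.2⟩⟩
  ext c
  simp only [chainSet, key, Set.mem_ofPred_eq]
  refine and_congr_right fun _ => and_congr_right fun _ => and_congr_right fun h => ?_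
  rw [h n (by simp)]

/-- Replacing all terms of a chain after the `n`-th by `λ`. -/
def extendChain (n : ℕ) (lam : Ptn) (c : ℕ → Ptn) (i : ℕ) : Ptn := if i ≤ n then c i else lam

theorem chainSet_succ {p : ℕ → Prop} {n : ℕ} (hn : p n) (γ lam : Ptn) :
    chainSet p (n + 1) γ lam = ⋃ κ ∈ (below lam : Set Ptn), extendChain n lam '' chainSet p n γ κ := by
  ext c
  simp only [Set.mem_iUnion, Finset.mem_coe, mem_below, Set.mem_image, exists_prop]
  constructor
  · rintro ⟨h0, h1, h2, h3⟩
    have h4 : ∀ i, n + 1 ≤ i → c i = lam := fun i hi =>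
      (eq_of_constant_from (fun i hi => h2 i (by omega)) hi).trans h3
    refine ⟨c n, h3 ▸ h1 n, fun i => if i ≤ n then c i else c n, ⟨by simp [h0], fun i => ?_,
      fun i hi => ?_, by simp⟩, ?_⟩
    · rcases lt_trichotomy i n with h | rfl | h
      · simpa [h.le, Nat.succ_le_of_lt h] using h1 i
      · simpa using HStrip.refl _
      · simpa [h.not_ge, (h.trans (Nat.lt_succ_self i)).not_ge] using HStrip.refl _
    · rcases lt_trichotomy i n with h | rfl | h
      · simpa [h.le, Nat.succ_le_of_lt h] using h2 i fun h' => hi ⟨h, h'.2⟩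
      · simp
      · simp [h.not_ge, (h.trans (Nat.lt_succ_self i)).not_ge]
    · funext i
      by_cases h : i ≤ n
      · simp [extendChain, h]
      · simp [extendChain, h, h4 i (by omega)]
  · rintro ⟨κ, hκ, c, ⟨h0, h1, h2, h3⟩, rfl⟩
    refine ⟨by simp [extendChain, h0], fun i => ?_, fun i hi => ?_, by simp [extendChain]⟩
    · rcases lt_trichotomy i n with h | rfl | h
      · simpa [extendChain, h.le, Nat.succ_le_of_lt h] using h1 i
      · simpa [extendChain, h3] using hκ
      · simpa [extendChain, h.not_ge, (h.trans (Nat.lt_succ_self i)).not_ge] using HStrip.refl _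
    · rcases lt_trichotomy i n with h | rfl | h
      · simpa [extendChain, h.le, Nat.succ_le_of_lt h] using
          h2 i fun h' => hi ⟨h.trans (Nat.lt_succ_self n), h'.2⟩
      · exact absurd ⟨Nat.lt_succ_self i, hn⟩ hi
      · simp [extendChain, h.not_ge, (h.trans (Nat.lt_succ_self i)).not_ge]

theorem extendChain_injOn (p : ℕ → Prop) (n : ℕ) (γ κ lam : Ptn) :
    Set.InjOn (extendChain n lam) (chainSet p n γ κ) := by
  rintro c ⟨-, -, h2, h3⟩ d ⟨-, -, h2', h3'⟩ h
  funext i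
  by_cases hi : i ≤ n
  · simpa [extendChain, hi] using congrFun h i
  · rw [eq_of_constant_from (fun i hi => h2 i (by omega)) (le_of_not_ge hi), h3,
      eq_of_constant_from (fun i hi => h2' i (by omega)) (le_of_not_ge hi), h3']

theorem finite_chainSet (p : ℕ → Prop) (n : ℕ) (γ lam : Ptn) : (chainSet p n γ lam).Finite := by
  induction n generalizing lam with
  | zero => exact (Set.finite_singleton fun _ => γ).subset (by rw [chainSet_zero]; exact fun c h => h.2)
  | succ n ih =>
    by_cases hn : p n
    · rw [chainSet_succ hn]
      exact (below lam).finite_toSet.biUnion fun κ _ => (ih κ).image _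
    · rw [chainSet_succ_of_not hn]
      exact ih lam

theorem sum_chainWeights (p : ℕ → Prop) (x : ℕ → R) (n : ℕ) (γ lam : Ptn) :
    (chainWeights p x n γ lam).sum = ∑ᶠ c ∈ chainSet p n γ lam, stepWeight p x n c := by
  induction n generalizing lam with
  | zero =>
    rw [chainSet_zero, chainWeights]
    split_ifs with h
    · simp [h, stepWeight]
    · simp [h]
  | succ n ih =>
    by_cases hn : p n
    · rw [chainSet_succ hn, chainWeights, if_pos hn, finsum_mem_biUnion, finsum_mem_coe_finset]
      · rw [Multiset.sum_sum]
        refine Finset.sum_congr rfl fun κ hκ => ?_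
        rw [Multiset.sum_map_mul_right, Multiset.map_id', ih,
          finsum_mem_image (extendChain_injOn p n γ κ lam),
          finsum_mem_mul' _ _ (finite_chainSet p n γ κ)]
        refine finsum_mem_congr rfl fun c hc => ?_
        rw [stepWeight, stepWeight, Finset.prod_range_succ, if_pos hn]
        congr 1
        · refine Finset.prod_congr rfl fun i hi => ?_
          have := Finset.mem_range.1 hi
          simp [extendChain, this.le, Nat.succ_le_of_lt this]
        · simp [extendChain, hc.2.2.2]
      · intro κ hκ κ' hκ' h
        refine Set.disjoint_left.2 ?_
        rintro _ ⟨c, hc, rfl⟩ ⟨d, hd, h'⟩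
        refine h (hc.2.2.2.symm.trans (Eq.trans ?_ hd.2.2.2))
        simpa [extendChain] using (congrFun h' n).symm
      · exact (below lam).finite_toSet
      · exact fun κ _ => (finite_chainSet p n γ κ).image _
    · rw [chainWeights_succ_of_not hn, chainSet_succ_of_not hn, ih]
      refine finsum_mem_congr rfl fun c _ => ?_
      rw [stepWeight, stepWeight, Finset.prod_range_succ, if_neg hn, mul_one]

open Classical in
theorem skewSchurF_eq (p : ℕ → Prop) (x : ℕ → R) (n : ℕ) (γ lam : Ptn) :
    skewSchurF (fun m => if m < n ∧ p m then x m else 0) lam γ =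
      (chainWeights p x n γ lam).sum := by
  set X : ℕ → R := fun m => if m < n ∧ p m then x m else 0
  rw [sum_chainWeights, skewSchurF]
  refine (finsum_set_coe_eq_finsum_mem {c | IsSchurChain γ lam c}).trans ?_
  have hmem : ∀ c ∈ chainSet p n γ lam, IsSchurChain γ lam c := fun c hc =>
    ⟨hc.1, hc.2.1, n, fun i hi =>
      (eq_of_constant_from (fun i hi => hc.2.2.1 i (by omega)) hi).trans hc.2.2.2⟩
  have hsupp : ∀ c, IsSchurChain γ lam c → chainWeight X c ≠ 0 → c ∈ chainSet p n γ lam := by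
    rintro c ⟨h0, h1, N, hN⟩ hc
    have hconst : ∀ i, ¬ (i < n ∧ p i) → c (i + 1) = c i := by
      intro i hi
      refine ((h1 i).eq_of_size_eq ?_).symm
      by_contra hlt
      refine hc ?_
      have hfin : (Function.mulSupport fun i => X i ^ ((c (i + 1)).size - (c i).size)) ⊆
          (Finset.range (max N (i + 1)) : Set ℕ) := by
        intro j hj
        by_contra hj'
        have : N ≤ j := by simp at hj'; omega
        exact hj (by simp [hN j this, hN (j + 1) (by omega)])
      rw [chainWeight, finprod_eq_prod_of_mulSupport_subset _ hfin]
      refine Finset.prod_eq_zero (i := i) (by simp) ?_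
      simp only [X, if_neg hi]
      exact zero_pow (by omega)
    refine ⟨h0, h1, hconst, ?_⟩
    rw [← hN (max N n) (le_max_left _ _),
      eq_of_constant_from (fun i hi => hconst i (by omega)) (le_max_right N n)]
  rw [finsum_mem_inter_support_eq' _ {c | IsSchurChain γ lam c} (chainSet p n γ lam)
    fun c hc => ?_]
  · refine finsum_mem_congr rfl fun c hc => ?_
    rw [chainWeight, stepWeight, finprod_eq_prod_of_mulSupport_subset (s := Finset.range n)]
    · refine Finset.prod_congr rfl fun i hi => ?_
      have := Finset.mem_range.1 hi
      by_cases hp : p i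
      · simp [X, hp, this]
      · simp [hp, hc.2.2.1 i fun h => hp h.2]
    · intro i hi
      by_contra h
      exact hi (by simp [hc.2.2.1 i fun h' => h (by simpa using h'.1)])
  · exact ⟨fun h => hsupp c h hc, hmem c⟩

end SkewSchur

section PlanePartitions

variable {K : Type*} [Field K]

open Classical in
/-- The variable attached to a step of a plane partition with profile `δ`. -/
noncomputable def stepVar (δ : ℕ → ℤ) (v : ℕ → K) (n : ℕ) : K :=
  if δ (n + 1) = 1 then (∏ t ∈ Finset.range (n + 1), v t)⁻¹ else ∏ t ∈ Finset.range (n + 1), v t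

theorem isDSPP_snoc (δ : ℕ → ℤ) (n : ℕ) (L : Fin (n + 1) → Ptn) (b : Ptn) :
    IsDSPP (n + 2) δ (Fin.snoc (α := fun _ => Ptn) L b) ↔ IsDSPP (n + 1) δ L ∧
      if δ (n + 1) = 1 then HStrip (L (Fin.last n)) b else HStrip b (L (Fin.last n)) := by
  have h1 : ∀ (i : ℕ) (hi : i < n + 1) (hi' : i < n + 1 + 1),
      Fin.snoc (α := fun _ => Ptn) L b ⟨i, hi'⟩ = L ⟨i, hi⟩ := fun i hi hi' =>
    Fin.snoc_castSucc (α := fun _ => Ptn) b L ⟨i, hi⟩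
  have h2 : ∀ hi' : n + 1 < n + 1 + 1, Fin.snoc (α := fun _ => Ptn) L b ⟨n + 1, hi'⟩ = b :=
    fun _ => Fin.snoc_last (α := fun _ => Ptn) b L
  constructor
  · refine fun h => ⟨fun i hi => ?_, ?_⟩
    · have := h i (by omega)
      rwa [h1 i (by omega), h1 (i + 1) hi] at this
    · have := h n (by omega)
      rwa [h1 n (by omega), h2] at this
  · rintro ⟨h, h'⟩ i hi
    rcases Nat.lt_or_ge (i + 1) (n + 1) with hlt | hge
    · rw [h1 i (by omega), h1 (i + 1) hlt]
      exact h i hlt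
    · obtain rfl : i = n := by omega
      rw [h1 i (by omega), h2]
      exact h'

open Classical in
theorem tsum_isDSPP (δ : ℕ → ℤ) {v : ℕ → K} (hv : ∀ i, v i ≠ 0) (n : ℕ) (a b : Ptn)
    (φ : K → ℝ≥0∞) :
    ∑' L : Fin (n + 1) → Ptn, (if IsDSPP (n + 1) δ L ∧ L 0 = a ∧ L (Fin.last n) = b then
        φ (∏ i : Fin (n + 1), v i ^ (L i).size) else 0) =
      walkSum (fun i => δ (i + 1) = 1) (stepVar δ v) n a b
        fun z => φ ((∏ t ∈ Finset.range (n + 1), v t) ^ b.size * z) := by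
  induction n generalizing b φ with
  | zero =>
    rw [tsum_eq_single (fun _ => b), walkSum]
    · have : IsDSPP (0 + 1) δ fun _ => b := fun i hi => by omega
      simp [this, eq_comm]
    · intro L hL
      refine if_neg fun h => hL (funext fun i => ?_)
      rw [← h.2.2, Fin.fin_one_eq_zero i]
      rfl
  | succ n ih =>
    set P := ∏ t ∈ Finset.range (n + 1), v t with hP
    have hP0 : P ≠ 0 := Finset.prod_ne_zero_iff.2 fun i _ => hv i
    calc
      _ = ∑' L : Fin (n + 1) → Ptn,
          if (if δ (n + 1) = 1 then HStrip (L (Fin.last n)) b else HStrip b (L (Fin.last n))) ∧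
            IsDSPP (n + 1) δ L ∧ L 0 = a then
          φ ((∏ i : Fin (n + 1), v i ^ (L i).size) * v (n + 1) ^ b.size) else 0 := by
        rw [← (Fin.snocEquiv fun _ => Ptn).tsum_eq, ENNReal.tsum_prod', tsum_eq_single b]
        · refine tsum_congr fun L => ?_
          have h0 : Fin.snoc (α := fun _ => Ptn) L b 0 = L 0 :=
            Fin.snoc_castSucc (α := fun _ => Ptn) b L 0
          have h1 : ∏ i : Fin (n + 1 + 1), v i ^ (Fin.snoc (α := fun _ => Ptn) L b i).size =
              (∏ i : Fin (n + 1), v i ^ (L i).size) * v (n + 1) ^ b.size := by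
            rw [Fin.prod_univ_castSucc]
            simp
          have h2 : Fin.snocEquiv (fun _ => Ptn) (b, L) = Fin.snoc (α := fun _ => Ptn) L b := rfl
          simp only [h2, isDSPP_snoc, h0, h1, Fin.snoc_last, and_true]
          exact if_congr (by rw [and_assoc, and_left_comm]) rfl rfl
        · intro c hc
          simp [Fin.snocEquiv_apply, hc]
      _ = ∑' c : Ptn, if (if δ (n + 1) = 1 then HStrip c b else HStrip b c) then
          ∑' L : Fin (n + 1) → Ptn, (if IsDSPP (n + 1) δ L ∧ L 0 = a ∧ L (Fin.last n) = c then
            φ ((∏ i : Fin (n + 1), v i ^ (L i).size) * v (n + 1) ^ b.size) else 0) else 0 := by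
        simp only [ite_tsum]
        rw [ENNReal.tsum_comm]
        refine tsum_congr fun L => ?_
        rw [tsum_eq_single (L (Fin.last n))]
        · simp only [and_true, ← ite_and]
        · intro c hc
          simp [hc.symm]
      _ = ∑' c : Ptn, if (if δ (n + 1) = 1 then HStrip c b else HStrip b c) then
          walkSum (fun i => δ (i + 1) = 1) (stepVar δ v) n a c
            (fun z => φ (P ^ c.size * z * v (n + 1) ^ b.size)) else 0 := by
        refine tsum_congr fun c => ?_
        rw [ih c fun z => φ (z * v (n + 1) ^ b.size)]
      _ = _ := by
        rw [walkSum, Finset.prod_range_succ, ← hP]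
        by_cases h : δ (n + 1) = 1
        · simp only [if_pos h]
          refine tsum_congr fun c => ?_
          split_ifs with hc
          · congr 1
            ext z
            rw [stepVar, if_pos h, ← hP, inv_pow, mul_pow]
            congr 1
            have : P ^ b.size = P ^ c.size * P ^ (b.size - c.size) := by
              rw [← pow_add, Nat.add_sub_cancel' hc.size_le]
            rw [this]
            field_simp
          · rfl
        · simp only [if_neg h]
          refine tsum_congr fun c => ?_
          split_ifs with hc
          · congr 1
            ext z
            rw [stepVar, if_neg h, ← hP, mul_pow]
            congr 1
            have : P ^ c.size = P ^ b.size * P ^ (c.size - b.size) := by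
              rw [← pow_add, Nat.add_sub_cancel' hc.size_le]
            rw [this]
            ring
          · rfl

end PlanePartitions

section InversionRatios

variable {K : Type*} [CommMonoid K]

open Classical in
theorem prod_map_crossRatios {M : Type*} [CommMonoid M] (p : ℕ → Prop) (x : ℕ → K) (y : K)
    (n : ℕ) (f : K → M) :
    ((crossRatios p x y n).map f).prod = ∏ i ∈ Finset.range n, if p i then f (x i * y) else 1 := by
  induction n with
  | zero => rfl
  | succ n ih =>
    rw [crossRatios, Finset.prod_range_succ, ← ih]
    split_ifs <;> simp [mul_comm]

open Classical in
theorem prod_map_inversionRatios {M : Type*} [CommMonoid M] (up : ℕ → Prop) (x : ℕ → K)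
    (n : ℕ) (f : K → M) :
    ((inversionRatios up x n).map f).prod = ∏ j ∈ Finset.range n, ∏ i ∈ Finset.range j,
      if up i ∧ ¬ up j then f (x i * x j) else 1 := by
  induction n with
  | zero => rfl
  | succ n ih =>
    rw [inversionRatios, Finset.prod_range_succ, ← ih]
    split_ifs with h
    · simp [h]
    · simp [h, prod_map_crossRatios, mul_comm]

theorem prod_fin_lt {M : Type*} [CommMonoid M] (n : ℕ) (p : ℕ → ℕ → Prop)
    [∀ i j, Decidable (p i j)] (f : ℕ → ℕ → M) :
    ∏ q ∈ Finset.univ.filter (fun q : Fin n × Fin n => q.1 < q.2 ∧ p q.1 q.2), f q.1 q.2 =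
      ∏ j ∈ Finset.range n, ∏ i ∈ Finset.range j, if p i j then f i j else 1 := by
  rw [Finset.prod_filter, Fintype.prod_prod_type_right,
    ← Fin.prod_univ_eq_prod_range (fun j => ∏ i ∈ Finset.range j, if p i j then f i j else 1)]
  refine Finset.prod_congr rfl fun j _ => ?_
  have := Fin.prod_univ_eq_prod_range (fun i => if i < (j : ℕ) ∧ p i j then f i j else 1) n
  simp only [Fin.lt_def]
  rw [this]
  refine (Finset.prod_subset (Finset.range_subset_range.2 j.2.le) fun i _ hi => ?_).symm.trans ?_
  · simp at hi
    simp [hi.not_gt]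
  · exact Finset.prod_congr rfl fun i hi => by simp [Finset.mem_range.1 hi]

theorem exists_of_mem_crossRatios {p : ℕ → Prop} {x : ℕ → K} {y : K} {n : ℕ} {r : K}
    (h : r ∈ crossRatios p x y n) : ∃ i < n, p i ∧ r = x i * y := by
  induction n with
  | zero => simp [crossRatios] at h
  | succ n ih =>
    rw [crossRatios] at h
    split_ifs at h with hn
    · rcases List.mem_cons.1 h with rfl | h
      · exact ⟨n, n.lt_succ_self, hn, rfl⟩
      · obtain ⟨i, hi, h⟩ := ih h
        exact ⟨i, hi.trans n.lt_succ_self, h⟩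
    · obtain ⟨i, hi, h⟩ := ih h
      exact ⟨i, hi.trans n.lt_succ_self, h⟩

theorem exists_of_mem_inversionRatios {up : ℕ → Prop} {x : ℕ → K} {n : ℕ} {r : K}
    (h : r ∈ inversionRatios up x n) : ∃ i j, i < j ∧ up i ∧ ¬ up j ∧ r = x i * x j := by
  induction n with
  | zero => simp [inversionRatios] at h
  | succ n ih =>
    rw [inversionRatios] at h
    split_ifs at h with hn
    · exact ih h
    · rcases List.mem_append.1 h with h | h
      · obtain ⟨i, hi, hp, rfl⟩ := exists_of_mem_crossRatios h
        exact ⟨i, n, hi, hp, hn, rfl⟩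
      · exact ih h

end InversionRatios

section Coefficients

theorem geoList_map {K K' : Type*} [CommMonoid K] [CommMonoid K'] (f : K →* K') (l : List K)
    (φ : K' → ℝ≥0∞) (z : K) : geoList (l.map f) φ (f z) = geoList l (φ ∘ f) z := by
  induction l generalizing z with
  | nil => rfl
  | cons r l ih => simp [geoList, geo, ← ih]

theorem hasSum_of_tsum_eq_natCast {Ω E : Type*} [DecidableEq E] {w : Ω → E} {e : E} {k : ℕ}
    (h : ∑' ω, (if w ω = e then (1 : ℝ≥0∞) else 0) = k) :
    HasSum (fun ω => if w ω = e then (1 : ℚ) else 0) k := by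
  rw [tsum_ite_eq_tsum_subtype (fun ω => w ω = e) fun _ => 1] at h
  have h1 : ({ω | w ω = e}.encard : ℝ≥0∞) = k := (ENNReal.tsum_set_one _).symm.trans h
  have h2 : {ω | w ω = e}.encard = k := by exact_mod_cast h1
  have hfin : {ω | w ω = e}.Finite := Set.finite_of_encard_eq_coe h2
  have h3 : hfin.toFinset.card = k := by
    rw [hfin.encard_eq_coe_toFinset_card] at h2
    exact_mod_cast h2
  have : HasSum (fun ω => if w ω = e then (1 : ℚ) else 0) _ := hasSum_sum_of_ne_finset_zero (f := fun ω => if w ω = e then (1 : ℚ) else 0)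
    (s := hfin.toFinset) fun ω hω => if_neg (by simpa using hω)
  rwa [Finset.sum_congr rfl fun ω hω => if_pos (by simpa using hω), Finset.sum_const, h3,
    nsmul_one] at this

variable {σ : Type*}

/-- Monomials, as a monoid homomorphism. -/
noncomputable def monomialHom (σ : Type*) : Multiplicative (σ →₀ ℕ) →* MvPowerSeries σ ℚ where
  toFun e := MvPowerSeries.monomial e.toAdd 1
  map_one' := rfl
  map_mul' e f := by simp [MvPowerSeries.monomial_mul_monomial]

open Classical in
theorem coeff_monomialHom (e : σ →₀ ℕ) (a : Multiplicative (σ →₀ ℕ)) :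
    MvPowerSeries.coeff e (monomialHom σ a) = if e = a.toAdd then 1 else 0 :=
  MvPowerSeries.coeff_monomial _ _ _

theorem monomialHom_injective : Function.Injective (monomialHom σ) := fun e f h => by
  classical
  have := congrArg (MvPowerSeries.coeff e.toAdd) h
  rw [coeff_monomialHom, coeff_monomialHom, if_pos rfl] at this
  by_contra hne
  rw [if_neg fun h => hne (Multiplicative.toAdd.injective h)] at this
  exact one_ne_zero this

open Classical in
/-- The test function detecting the exponent `e`. -/
noncomputable def detect (e : σ →₀ ℕ) (z : Multiplicative (σ →₀ ℕ)) : ℝ≥0∞ :=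
  if z.toAdd = e then 1 else 0

open Classical in
theorem detect_mul (e : σ →₀ ℕ) (r : Multiplicative (σ →₀ ℕ)) :
    (fun z => detect e (z * r)) = fun z => if r.toAdd ≤ e then detect (e - r.toAdd) z else 0 := by
  funext z
  by_cases h : r.toAdd ≤ e
  · simp [detect, h, eq_tsub_iff_add_eq_of_le h]
  · have : z.toAdd + r.toAdd ≠ e := fun h' => h (h' ▸ le_add_self)
    simp [detect, h, this]

open Classical in
theorem geoList_detect_mul (l : List (Multiplicative (σ →₀ ℕ))) (e : σ →₀ ℕ)
    (r z : Multiplicative (σ →₀ ℕ)) :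
    geoList l (fun z => detect e (z * r)) z =
      if r.toAdd ≤ e then geoList l (detect (e - r.toAdd)) z else 0 := by
  rw [detect_mul]
  split_ifs with h
  · rfl
  · clear h
    induction l generalizing z with
    | nil => rfl
    | cons r l ih => simp [geoList, geo, ih]

open Classical in
theorem wsum_geoList_cons (N : Multiset (Multiplicative (σ →₀ ℕ)))
    (r : Multiplicative (σ →₀ ℕ)) (l : List (Multiplicative (σ →₀ ℕ))) (e : σ →₀ ℕ) :
    wsum N (geoList (r :: l) (detect e)) = wsum N (geoList l (detect e)) +
      if r.toAdd ≤ e then wsum N (geoList (r :: l) (detect (e - r.toAdd))) else 0 := by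
  rw [← wsum_ite, wsum, wsum, wsum, ← Multiset.sum_map_add]
  simp only [← geoList_detect_mul, ← geoList_cons_eq_add]

/-- The power series with prescribed natural coefficients. -/
def countSeries (c : (σ →₀ ℕ) → ℕ) : MvPowerSeries σ ℚ := fun e => c e

theorem coeff_countSeries (c : (σ →₀ ℕ) → ℕ) (e : σ →₀ ℕ) :
    MvPowerSeries.coeff e (countSeries c) = c e := rfl

theorem toAdd_eq_iff {a : Multiplicative (σ →₀ ℕ)} {e : σ →₀ ℕ} :
    e = a.toAdd ↔ Multiplicative.ofAdd e = a :=
  ⟨fun h => h ▸ rfl, fun h => h ▸ rfl⟩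

open Classical in
theorem exists_series (N : Multiset (Multiplicative (σ →₀ ℕ)))
    (l : List (Multiplicative (σ →₀ ℕ))) (hl : ∀ r ∈ l, r ≠ 1) :
    ∃ c : (σ →₀ ℕ) → ℕ, (∀ e, wsum N (geoList l (detect e)) = c e) ∧
      countSeries c * (l.map fun r => 1 - monomialHom σ r).prod =
        (N.map (monomialHom σ)).sum := by
  induction l with
  | nil =>
    refine ⟨fun e => N.count (Multiplicative.ofAdd e), fun e => ?_, ?_⟩
    · simp only [geoList]
      induction N using Multiset.induction_on with
      | empty => simp [wsum]
      | cons a N ih =>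
        rw [wsum] at ih ⊢
        rw [Multiset.map_cons, Multiset.sum_cons, ih, Multiset.count_cons, add_comm, detect]
        simp only [eq_comm (a := a.toAdd), toAdd_eq_iff]
        push_cast
        rfl
    · rw [List.map_nil, List.prod_nil, mul_one]
      ext e
      rw [coeff_countSeries]
      induction N using Multiset.induction_on with
      | empty => simp
      | cons a N ih =>
        rw [Multiset.map_cons, Multiset.sum_cons, map_add, ← ih, Multiset.count_cons,
          coeff_monomialHom, add_comm]
        simp only [toAdd_eq_iff]
        push_cast
        rfl
  | cons r l ih =>
    obtain ⟨d, hd, hd'⟩ := ih fun r hr => hl r (by simp [hr])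
    have hr : r.toAdd ≠ 0 := hl r (by simp)
    have hex : ∀ e, ∃ k : ℕ, wsum N (geoList (r :: l) (detect e)) = k := by
      intro e
      induction e using WellFoundedLT.induction with
      | ind e ih =>
        rw [wsum_geoList_cons, hd]
        split_ifs with h
        · have hlt : e - r.toAdd < e := by
            refine lt_of_le_of_ne tsub_le_self fun h' => hr ?_
            have := tsub_add_cancel_of_le h
            rw [h'] at this
            exact add_eq_left.1 this
          obtain ⟨k, hk⟩ := ih _ hlt
          exact ⟨d e + k, by rw [hk, Nat.cast_add]⟩
        · exact ⟨d e, by simp⟩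
    choose c hc using hex
    refine ⟨c, hc, ?_⟩
    rw [List.map_cons, List.prod_cons, ← mul_assoc, ← hd']
    congr 1
    ext e
    have key := wsum_geoList_cons N r l e
    rw [hc, hc, hd] at key
    rw [mul_sub, mul_one, map_sub, monomialHom, MonoidHom.coe_mk, OneHom.coe_mk,
      MvPowerSeries.coeff_mul_monomial]
    simp only [coeff_countSeries]
    split_ifs at key ⊢
    · have : c e = d e + c (e - r.toAdd) := by exact_mod_cast key
      simp [this]
    · have : c e = d e := by simpa using key
      simp [this]

instance : T2Space (MvPowerSeries σ ℚ) := inferInstanceAs (T2Space ((σ →₀ ℕ) → ℚ))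

open Classical in
theorem tsum_monomialHom_mul_prod {Ω : Type*} (w : Ω → Multiplicative (σ →₀ ℕ))
    (N : Multiset (Multiplicative (σ →₀ ℕ))) (l : List (Multiplicative (σ →₀ ℕ)))
    (hl : ∀ r ∈ l, r ≠ 1)
    (h : ∀ e, ∑' ω, detect e (w ω) = wsum N (geoList l (detect e))) :
    (∑' ω, monomialHom σ (w ω)) * (l.map fun r => 1 - monomialHom σ r).prod =
      (N.map (monomialHom σ)).sum := by
  obtain ⟨c, hc, hc'⟩ := exists_series N l hl
  rw [← hc']
  congr 1
  refine HasSum.tsum_eq ?_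
  refine Pi.hasSum.2 fun e => ?_
  have := hasSum_of_tsum_eq_natCast (w := fun ω => (w ω).toAdd) (e := e) (k := c e)
    ((h e).trans (hc e))
  convert this using 2 with ω
  · exact (coeff_monomialHom e (w ω)).trans (if_congr eq_comm rfl rfl)
  · rfl

/-- Monomials, in the field of fractions. -/
noncomputable def fracMonomialHom : Multiplicative (ℕ →₀ ℕ) →* KU :=
  (algebraMap RU KU : RU →* KU).comp (monomialHom ℕ)

theorem fracMonomialHom_injective : Function.Injective fracMonomialHom :=
  (IsFractionRing.injective RU KU).comp monomialHom_injective

theorem algebraMap_tsum_mul_prod {Ω : Type*} (w : Ω → Multiplicative (ℕ →₀ ℕ)) (M : Multiset KU)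
    (l : List (Multiplicative (ℕ →₀ ℕ))) (hl : ∀ r ∈ l, r ≠ 1)
    (h : ∀ φ : KU → ℝ≥0∞,
      ∑' ω, φ (fracMonomialHom (w ω)) = wsum M (geoList (l.map fracMonomialHom) φ)) :
    algebraMap RU KU (∑' ω, monomialHom ℕ (w ω)) * (l.map fun r => 1 - fracMonomialHom r).prod =
      M.sum := by
  classical
  have hM : ∀ m ∈ M, ∃ e, fracMonomialHom e = m := by
    intro m hm
    by_contra hne
    have h0 := h fun z => if z ∈ Set.range fracMonomialHom then 0 else 1
    simp only [Set.mem_range_self, if_true, tsum_zero] at h0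
    have h1 := Multiset.single_le_sum (fun _ _ => zero_le) _ (Multiset.mem_map_of_mem
      (geoList (l.map fracMonomialHom) fun z => if z ∈ Set.range fracMonomialHom then 0 else 1) hm)
    have h2 := (le_geoList _ _ _).trans (h1.trans h0.symm.le)
    rw [if_neg (by simpa using hne)] at h2
    simp at h2
  obtain ⟨N, rfl⟩ : ∃ N : Multiset (Multiplicative (ℕ →₀ ℕ)), N.map fracMonomialHom = M := by
    choose! g hg using hM
    exact ⟨M.map g, by rw [Multiset.map_map]; exact (Multiset.map_congr rfl hg).trans M.map_id⟩
  have key := tsum_monomialHom_mul_prod w N l hl fun e => by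
    have := h (Function.extend fracMonomialHom (detect e) 0)
    simp only [fracMonomialHom_injective.extend_apply] at this
    rw [this, wsum, wsum, Multiset.map_map]
    congr 2
    funext z
    simp [geoList_map, Function.extend_comp fracMonomialHom_injective]
  have := congrArg (algebraMap RU KU) key
  rw [map_mul, map_list_prod, map_multiset_sum, List.map_map, Multiset.map_map] at this
  refine Eq.trans ?_ this
  congr 3
  funext r
  simp [fracMonomialHom]

end Coefficients

section TraceGeneratingFunction

/-- The exponent of `u_i`. -/
noncomputable def uExponent (i : ℕ) : Multiplicative (ℕ →₀ ℕ) :=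
  Multiplicative.ofAdd (Finsupp.single i 1)

theorem fracMonomialHom_uExponent (i : ℕ) : fracMonomialHom (uExponent i) = algebraMap RU KU (u i) :=
  rfl

theorem prod_uExponent_ne_one {s : Finset ℕ} (hs : s.Nonempty) : ∏ t ∈ s, uExponent t ≠ 1 := by
  intro h
  obtain ⟨i, hi⟩ := hs
  have h' : ∑ t ∈ s, Finsupp.single t 1 = (0 : ℕ →₀ ℕ) := h
  simpa using Finset.sum_eq_zero_iff.1 h' i hi

theorem algebraMap_u_ne_zero (i : ℕ) : algebraMap RU KU (u i) ≠ 0 := by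
  intro h
  have h0 : u i = 0 := IsFractionRing.injective RU KU (h.trans (map_zero _).symm)
  simpa [u] using congrArg (MvPowerSeries.coeff (Finsupp.single i 1)) h0

theorem algebraMap_U (n : ℕ) :
    algebraMap RU KU (U n) = ∏ t ∈ Finset.range n, algebraMap RU KU (u t) :=
  map_prod _ _ _

theorem inv_algebraMap_U_mul {i j : ℕ} (hij : i ≤ j) :
    (algebraMap RU KU (U i))⁻¹ * algebraMap RU KU (U j) =
      fracMonomialHom (∏ t ∈ Finset.Ico i j, uExponent t) := by
  have h0 : algebraMap RU KU (U i) ≠ 0 := by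
    rw [algebraMap_U]
    exact Finset.prod_ne_zero_iff.2 fun t _ => algebraMap_u_ne_zero t
  rw [inv_mul_eq_iff_eq_mul₀ h0, map_prod, algebraMap_U, algebraMap_U]
  exact (Finset.prod_range_mul_prod_Ico _ hij).symm

theorem exists_exponents (δ : ℕ → ℤ) (n : ℕ) : ∃ l : List (Multiplicative (ℕ →₀ ℕ)),
    (∀ r ∈ l, r ≠ 1) ∧ l.map fracMonomialHom =
      inversionRatios (fun i => δ (i + 1) = 1) (stepVar δ fun t => algebraMap RU KU (u t)) n := by
  have key : ∀ r ∈ inversionRatios (fun i => δ (i + 1) = 1)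
      (stepVar δ fun t => algebraMap RU KU (u t)) n, ∃ e, e ≠ 1 ∧ fracMonomialHom e = r := by
    intro r hr
    obtain ⟨i, j, hij, hi, hj, rfl⟩ := exists_of_mem_inversionRatios hr
    refine ⟨∏ t ∈ Finset.Ico (i + 1) (j + 1), uExponent t, prod_uExponent_ne_one ?_, ?_⟩
    · exact Finset.nonempty_Ico.2 (by omega)
    · rw [← inv_algebraMap_U_mul (by omega), stepVar, stepVar, if_pos hi, if_neg hj,
        algebraMap_U, algebraMap_U]
  choose! g hg using key
  refine ⟨(inversionRatios (fun i => δ (i + 1) = 1)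
    (stepVar δ fun t => algebraMap RU KU (u t)) n).map g, fun r hr => ?_, ?_⟩
  · obtain ⟨s, hs, rfl⟩ := List.mem_map.1 hr
    exact (hg s hs).1
  · rw [List.map_map]
    exact (List.map_congr_left fun r hr => (hg r hr).2).trans (List.map_id _)

theorem wsum_bind {K L : Type*} (M : Multiset K) (f : K → Multiset L) (φ : L → ℝ≥0∞) :
    wsum (M.bind f) φ = wsum M fun z => wsum (f z) φ := by
  simp only [wsum, Multiset.map_bind, Multiset.sum_bind]

theorem wsum_map {K L : Type*} (M : Multiset K) (f : K → L) (φ : L → ℝ≥0∞) :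
    wsum (M.map f) φ = wsum M fun z => φ (f z) := by
  simp only [wsum, Multiset.map_map, Function.comp_def]

variable {K : Type*} [Field K]

/-- The weights of all pairs of chains from a common `γ` to `a` and to `b`. -/
noncomputable def pairWeights (up : ℕ → Prop) (x : ℕ → K) (n : ℕ) (a b : Ptn) : Multiset K :=
  ∑ γ ∈ a.finite_le.toFinset, (chainWeights (fun i => ¬ up i) x n γ a).bind fun z =>
    (chainWeights up x n γ b).map fun w => z * w

theorem walkSum_eq_wsum_pairWeights (up : ℕ → Prop) (x : ℕ → K) (n : ℕ) (a b : Ptn)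
    (φ : K → ℝ≥0∞) :
    walkSum up x n a b φ =
      wsum (pairWeights up x n a b) (geoList (inversionRatios up x n) φ) := by
  rw [walkSum_eq, pairWeights, wsum_finset_sum, tsum_eq_sum (s := a.finite_le.toFinset)]
  · simp only [wsum_bind, wsum_map]
  · intro γ hγ
    have : chainWeights (fun i => ¬ up i) x n γ a = 0 := by
      by_contra h
      exact hγ (by simpa using chainWeights_toFun_le h)
    simp [this, wsum]

theorem sum_pairWeights (up : ℕ → Prop) (x : ℕ → K) (n : ℕ) (a b : Ptn) :
    (pairWeights up x n a b).sum =
      ∑ᶠ γ, (chainWeights (fun i => ¬ up i) x n γ a).sum * (chainWeights up x n γ b).sum := by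
  rw [finsum_eq_sum_of_support_subset (s := a.finite_le.toFinset), pairWeights, Multiset.sum_sum]
  · refine Finset.sum_congr rfl fun γ _ => ?_
    rw [Multiset.sum_bind]
    rw [Multiset.map_congr rfl fun z _ => Multiset.sum_map_mul_left, Multiset.sum_map_mul_right,
      Multiset.map_id', Multiset.map_id']
  · intro γ hγ
    have : chainWeights (fun i => ¬ up i) x n γ a ≠ 0 := by
      intro h
      exact hγ (by simp [h])
    simpa using chainWeights_toFun_le this

end TraceGeneratingFunction

/-- **Trace generating function, open form** (Theorem 3.2, equation (3.1)):
for a profile `δ = (δ_1, …, δ_h)` and fixed partitions `λ^0`, `λ^h`,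
`Σ_{ω ∈ DSPP_δ(λ^0, λ^h)} ∏_{i=0}^h u_i^{|λ^i|}
  = U_{h+1}^{|λ^h|} · ∏_{1≤i<j≤h, δ_i>δ_j} (1 - U_i⁻¹ U_j)⁻¹
      · Σ_γ s_{λ^0/γ}({U_i : δ_i = -1}) s_{λ^h/γ}({U_i⁻¹ : δ_i = 1})`. -/
theorem trace_generating_function_open (h : ℕ) (hh : 1 ≤ h) (δ : ℕ → ℤ)
    (hδ : IsProfile h δ) (lam0 lamh : Ptn) :
    algebraMap RU KU
        (∑' ω : {L : Fin (h + 1) → Ptn //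
            IsDSPP (h + 1) δ L ∧ L 0 = lam0 ∧ L (Fin.last h) = lamh},
          ∏ i : Fin (h + 1), u (i : ℕ) ^ (ω.1 i).size)
    = algebraMap RU KU (U (h + 1)) ^ lamh.size *
        (∏ q ∈ Finset.univ.filter
            (fun q : Fin h × Fin h => q.1 < q.2 ∧ δ ((q.1 : ℕ) + 1) > δ ((q.2 : ℕ) + 1)),
            (1 - (algebraMap RU KU (U ((q.1 : ℕ) + 1)))⁻¹ *
              algebraMap RU KU (U ((q.2 : ℕ) + 1)))⁻¹) *
        ∑ᶠ γ : Ptn,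
          skewSchurF (fun n => if n < h ∧ δ (n + 1) = -1
              then algebraMap RU KU (U (n + 1)) else 0) lam0 γ *
            skewSchurF (fun n => if n < h ∧ δ (n + 1) = 1
              then (algebraMap RU KU (U (n + 1)))⁻¹ else 0) lamh γ := by
  classical
  set v : ℕ → KU := fun t => algebraMap RU KU (u t)
  set up : ℕ → Prop := fun i => δ (i + 1) = 1
  have hdown : ∀ n < h, (δ (n + 1) = -1 ↔ ¬ up n) := fun n hn => by
    rcases hδ (n + 1) (by omega) (by omega) with h1 | h1 <;> simp [up, h1]
  obtain ⟨l, hl1, hl⟩ := exists_exponents δ h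
  have hw : ∀ L : Fin (h + 1) → Ptn,
      fracMonomialHom (∏ i : Fin (h + 1), uExponent i ^ (L i).size) =
        ∏ i : Fin (h + 1), v i ^ (L i).size := fun L => by
    simp only [map_prod, map_pow, fracMonomialHom_uExponent, v]
  have key := algebraMap_tsum_mul_prod
    (fun ω : {L : Fin (h + 1) → Ptn // IsDSPP (h + 1) δ L ∧ L 0 = lam0 ∧ L (Fin.last h) = lamh} =>
      ∏ i : Fin (h + 1), uExponent i ^ (ω.1 i).size)
    ((pairWeights up (stepVar δ v) h lam0 lamh).map
      (· * algebraMap RU KU (U (h + 1)) ^ lamh.size)) l hl1 fun φ => by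
    simp only [hw]
    rw [← tsum_ite_eq_tsum_subtype
      (fun L : Fin (h + 1) → Ptn => IsDSPP (h + 1) δ L ∧ L 0 = lam0 ∧ L (Fin.last h) = lamh)
      fun L => φ (∏ i : Fin (h + 1), v i ^ (L i).size),
      tsum_isDSPP δ algebraMap_u_ne_zero, walkSum_eq_wsum_pairWeights, wsum_map, hl, ← algebraMap_U]
    simp only [mul_comm (algebraMap RU KU (U (h + 1)) ^ lamh.size), v, up]
    exact congrArg (wsum _) (funext fun z => geoList_mul_right _ _ _ _)
  have hLHS : (fun ω : {L : Fin (h + 1) → Ptn //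
      IsDSPP (h + 1) δ L ∧ L 0 = lam0 ∧ L (Fin.last h) = lamh} =>
      monomialHom ℕ (∏ i : Fin (h + 1), uExponent i ^ (ω.1 i).size)) =
      fun ω => ∏ i : Fin (h + 1), u (i : ℕ) ^ (ω.1 i).size := by
    funext ω
    rw [map_prod]
    simp only [map_pow]
    rfl
  have hne : (l.map fun r => 1 - fracMonomialHom r).prod ≠ 0 := by
    refine List.prod_ne_zero fun h0 => ?_
    obtain ⟨r, hr, hr0⟩ := List.mem_map.1 h0
    exact hl1 r hr (fracMonomialHom_injective
      ((sub_eq_zero.1 hr0).symm.trans (map_one fracMonomialHom).symm))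
  have hprod : (∏ q ∈ Finset.univ.filter
      (fun q : Fin h × Fin h => q.1 < q.2 ∧ δ ((q.1 : ℕ) + 1) > δ ((q.2 : ℕ) + 1)),
      (1 - (algebraMap RU KU (U ((q.1 : ℕ) + 1)))⁻¹ *
        algebraMap RU KU (U ((q.2 : ℕ) + 1)))⁻¹) =
      ((l.map fun r => 1 - fracMonomialHom r).prod)⁻¹ := by
    have h1 : ((l.map fun r => 1 - fracMonomialHom r).prod)⁻¹ =
        ((inversionRatios up (stepVar δ v) h).map fun r => (1 - r)⁻¹).prod := by
      rw [← hl, List.map_map, List.prod_inv, List.map_map]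
      rfl
    rw [h1, prod_map_inversionRatios, prod_fin_lt h (fun i j => δ (i + 1) > δ (j + 1))
      fun i j => (1 - (algebraMap RU KU (U (i + 1)))⁻¹ * algebraMap RU KU (U (j + 1)))⁻¹]
    refine Finset.prod_congr rfl fun j hj => Finset.prod_congr rfl fun i hi => ?_
    have hj' := Finset.mem_range.1 hj
    have hi' := Finset.mem_range.1 hi
    have hiff : δ (i + 1) > δ (j + 1) ↔ up i ∧ ¬ up j := by
      rcases hδ (i + 1) (by omega) (by omega) with h1 | h1 <;>
      rcases hδ (j + 1) (by omega) (by omega) with h2 | h2 <;> simp [up, h1, h2]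
    by_cases hc : up i ∧ ¬ up j
    · rw [if_pos (hiff.2 hc), if_pos hc, stepVar, stepVar, if_pos hc.1, if_neg hc.2,
        algebraMap_U, algebraMap_U]
    · rw [if_neg fun h' => hc (hiff.1 h'), if_neg hc]
  have hskew0 : ∀ γ, skewSchurF (fun n => if n < h ∧ δ (n + 1) = -1
      then algebraMap RU KU (U (n + 1)) else 0) lam0 γ =
      (chainWeights (fun i => ¬ up i) (stepVar δ v) h γ lam0).sum := fun γ => by
    rw [← skewSchurF_eq]
    congr 1
    funext n
    by_cases hn : n < h
    · simp only [hn, true_and, hdown n hn]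
      refine ite_congr rfl (fun hn' => ?_) fun _ => rfl
      rw [stepVar, if_neg hn', algebraMap_U]
    · simp [hn]
  have hskewh : ∀ γ, skewSchurF (fun n => if n < h ∧ δ (n + 1) = 1
      then (algebraMap RU KU (U (n + 1)))⁻¹ else 0) lamh γ =
      (chainWeights up (stepVar δ v) h γ lamh).sum := fun γ => by
    rw [← skewSchurF_eq]
    congr 1
    funext n
    by_cases hn : n < h ∧ up n
    · rw [if_pos hn, if_pos hn, stepVar, if_pos hn.2, algebraMap_U]
    · rw [if_neg hn, if_neg hn]
  rw [hLHS, Multiset.sum_map_mul_right, Multiset.map_id', sum_pairWeights] at key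
  simp only [hskew0, hskewh]
  rw [hprod, (eq_mul_inv_iff_mul_eq₀ hne).2 key]
  ring
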